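/- arXiv:1105.4135 — 2 statements merged into one kernel-verified Lean document; each statement's English description precedes it below -/
import Mathlib

section
/- (Variadic Substitution Lemma for Terms) Let M be a structure for a variadic language L and let s be an assignment. If r and t are terms of L such that t is substitutable for the variable x in r, then the syntactic interpretations satisfy r(x|t)^s = r^{s(x|t^s)}. -/
/-- A first-order variadic language: constant symbols including a numeral for each
natural number, a countable set of variables (with decidable equality),
`n`-ary function symbols, variadic function symbols, and predicate symbols. -/
structure VarLang where
  Const : Type
  num : ℕ → Const
  Var : Type
  varDecEq : DecidableEq Var
  varCountable : Countable Var
  Func : ℕ → Type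
  VFunc : Type
  Pred : ℕ → Type

attribute [instance] VarLang.varDecEq VarLang.varCountable

/-- Terms of a variadic language. `app` applies an `n`-ary function symbol to `n` terms,
`vapp` applies a variadic function symbol to a (nonempty) tuple of terms, and
`ell G u x v` is the ellipsis term `G(u(𝟎)⋯ₓu(v))`. -/
inductive Term (L : VarLang) : Type
  | const : L.Const → Term L
  | var : L.Var → Term L
  | app : {n : ℕ} → L.Func n → (Fin n → Term L) → Term L
  | vapp : {n : ℕ} → L.VFunc → (Fin (n + 1) → Term L) → Term L
  | ell : L.VFunc → Term L → L.Var → Term L → Term L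

namespace Term

variable {L : VarLang}

/-- The free variables of a term. -/
def fv : Term L → Set L.Var
  | const _ => ∅
  | var x => {x}
  | app _ ts => ⋃ i, (ts i).fv
  | vapp _ ts => ⋃ i, (ts i).fv
  | ell _ u x v => (u.fv \ {x}) ∪ v.fv

/-- Substitution `r(x|t)` of the term `t` for the variable `x` in a term `r`. -/
def subst : Term L → L.Var → Term L → Term L
  | const c, _, _ => const c
  | var y, x, t => if y = x then t else var y
  | app f ts, x, t => app f fun i => (ts i).subst x t
  | vapp G ts, x, t => vapp G fun i => (ts i).subst x t
  | ell G u y v, x, t =>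
      if y = x then ell G u y (v.subst x t)
      else ell G (u.subst x t) y (v.subst x t)

/-- Substitutability of the term `t` for the variable `x` in a term. -/
def Substitutable (t : Term L) (x : L.Var) : Term L → Prop
  | const _ => True
  | var _ => True
  | app _ ts => ∀ i, Substitutable t x (ts i)
  | vapp _ ts => ∀ i, Substitutable t x (ts i)
  | ell G u y v =>
      x ∉ (ell G u y v).fv ∨ (y = x ∧ Substitutable t x v) ∨
        (y ∉ t.fv ∧ Substitutable t x u ∧ Substitutable t x v)

/-- The depth of a term. -/
def depth : Term L → ℕ
  | const _ => 0
  | var _ => 0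
  | app _ ts => (Finset.univ.sup fun i => (ts i).depth) + 1
  | vapp _ ts => (Finset.univ.sup fun i => (ts i).depth) + 1
  | ell _ u _ v => max u.depth v.depth + 1

/-- Substituting a constant symbol for a variable does not change the depth of a term. -/
lemma depth_subst_const (x : L.Var) (c : L.Const) :
    ∀ u : Term L, (u.subst x (const c)).depth = u.depth
  | const _ => rfl
  | var y => by by_cases h : y = x <;> simp [subst, h, depth]
  | app f ts => by
      simp only [subst, depth]
      congr 1
      exact Finset.sup_congr rfl fun i _ => depth_subst_const x c (ts i)
  | vapp G ts => by
      simp only [subst, depth]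
      congr 1
      exact Finset.sup_congr rfl fun i _ => depth_subst_const x c (ts i)
  | ell G u y v => by
      by_cases h : y = x <;>
        simp [subst, h, depth, depth_subst_const x c u, depth_subst_const x c v]

end Term

/-- A structure for a variadic language: universe `ℕ`, numerals interpreted standardly,
`n`-ary function symbols as functions `ℕⁿ → ℕ`, variadic function symbols as functions
on finite sequences of naturals, and predicate symbols as relations. -/
structure VarStruct (L : VarLang) where
  constI : L.Const → ℕ
  num_eq : ∀ n, constI (L.num n) = n
  funcI : {n : ℕ} → L.Func n → (Fin n → ℕ) → ℕ
  vfuncI : L.VFunc → List ℕ → ℕ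
  predI : {n : ℕ} → L.Pred n → (Fin n → ℕ) → Prop

namespace Term

variable {L : VarLang}

/-- The syntactic interpretation `t^s` of a term, by recursion on term depth:
`G(u(𝟎)⋯ₓu(v))^s = G^M(u(x|𝟎)^s, …, u(x|𝐦)^s)` where `m = v^s`. -/
def syn (M : VarStruct L) : Term L → (L.Var → ℕ) → ℕ
  | const c, _ => M.constI c
  | var x, s => s x
  | app f ts, s => M.funcI f fun i => (ts i).syn M s
  | vapp G ts, s => M.vfuncI G (List.ofFn fun i => (ts i).syn M s)
  | ell G u x v, s =>
      M.vfuncI G <| (List.range (v.syn M s + 1)).map fun k =>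
        ((u.subst x (const (L.num k))).syn M s)
termination_by t _ => t.depth
decreasing_by
  all_goals first
    | exact Nat.lt_succ_of_le (Finset.le_sup (f := fun i => (ts i).depth) (Finset.mem_univ i))
    | (rw [Term.depth_subst_const]; exact Nat.lt_succ_of_le (le_max_left _ _))
    | exact Nat.lt_succ_of_le (le_max_right _ _)

/-- The semantic interpretation `t_s` of a term, by structural recursion:
`G(u(𝟎)⋯ₓu(v))_s = G^M(u_{s(x|0)}, …, u_{s(x|m)})` where `m = v_s`. -/
def sem (M : VarStruct L) : Term L → (L.Var → ℕ) → ℕ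
  | const c, _ => M.constI c
  | var x, s => s x
  | app f ts, s => M.funcI f fun i => (ts i).sem M s
  | vapp G ts, s => M.vfuncI G (List.ofFn fun i => (ts i).sem M s)
  | ell G u x v, s =>
      M.vfuncI G <| (List.range (v.sem M s + 1)).map fun k =>
        u.sem M (Function.update s x k)

end Term

namespace Term

variable {L : VarLang}

/-- The semantic interpretation depends only on the values of the free variables. -/
lemma sem_congr (M : VarStruct L) (t : Term L) :
    ∀ {s s' : L.Var → ℕ}, (∀ y ∈ t.fv, s y = s' y) → t.sem M s = t.sem M s' := by
  induction t with
  | const c => intros; rfl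
  | var y => intro s s' h; exact h y rfl
  | app f ts ih =>
    intro s s' h
    simp only [sem]
    congr 1
    funext i
    exact ih i fun y hy => h y (Set.mem_iUnion.2 ⟨i, hy⟩)
  | vapp G ts ih =>
    intro s s' h
    simp only [sem]
    congr 2
    funext i
    exact ih i fun y hy => h y (Set.mem_iUnion.2 ⟨i, hy⟩)
  | ell G u y v ihu ihv =>
    intro s s' h
    have hu : ∀ k, u.sem M (Function.update s y k) = u.sem M (Function.update s' y k) := by
      intro k
      refine ihu fun z hz => ?_
      by_cases hzy : z = y
      · simp [hzy]
      · simpa [hzy] using h z (Or.inl ⟨hz, hzy⟩)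
    simp only [sem, ihv fun z hz => h z (Or.inr hz), hu]

/-- Updating a variable that is not free does not change the semantic interpretation. -/
lemma sem_update_of_notMem_fv (M : VarStruct L) {t : Term L} {x : L.Var} (hx : x ∉ t.fv)
    (s : L.Var → ℕ) (n : ℕ) : t.sem M (Function.update s x n) = t.sem M s :=
  sem_congr M t fun _ hy => Function.update_of_ne (ne_of_mem_of_not_mem hy hx) _ _

/-- Substituting for a variable that is not free does nothing. -/
lemma subst_of_notMem_fv (r t : Term L) (x : L.Var) (hx : x ∉ r.fv) : r.subst x t = r := by
  induction r with
  | const c => rfl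
  | var y => exact if_neg fun h => hx h.symm
  | app f ts ih =>
    simp only [subst]
    congr 1
    funext i
    exact ih i fun h => hx (Set.mem_iUnion.2 ⟨i, h⟩)
  | vapp G ts ih =>
    simp only [subst]
    congr 1
    funext i
    exact ih i fun h => hx (Set.mem_iUnion.2 ⟨i, h⟩)
  | ell G u y v ihu ihv =>
    have hv := ihv fun h => hx (Or.inr h)
    by_cases hyx : y = x
    · simp [subst, hyx, hv]
    · have hu := ihu fun h => hx (Or.inl ⟨h, fun h' => hyx h'.symm⟩)
      simp [subst, hyx, hu, hv]

/-- The substitution lemma for the semantic interpretation. -/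
lemma sem_subst (M : VarStruct L) (t : Term L) (x : L.Var) (r : Term L) :
    ∀ s : L.Var → ℕ, Substitutable t x r →
      (r.subst x t).sem M s = r.sem M (Function.update s x (t.sem M s)) := by
  induction r with
  | const c => intros; rfl
  | var y =>
    intro s _
    by_cases hyx : y = x <;> simp [subst, sem, hyx]
  | app f ts ih =>
    intro s h
    simp only [subst, sem, ih _ s (h _)]
  | vapp G ts ih =>
    intro s h
    simp only [subst, sem, ih _ s (h _)]
  | ell G u y v ihu ihv =>
    intro s h
    by_cases hx : x ∈ (ell G u y v).fv
    · by_cases hyx : y = x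
      · subst hyx
        have hv : Substitutable t y v := by
          rcases h with h | h | h
          exacts [absurd hx h, h.2, h.2.2]
        simp [subst, sem, ihv s hv]
      · obtain ⟨hy, hu, hv⟩ : y ∉ t.fv ∧ Substitutable t x u ∧ Substitutable t x v := by
          rcases h with h | h | h
          exacts [absurd hx h, absurd h.1 hyx, h]
        simp only [subst, if_neg hyx, sem, ihv s hv, ihu _ hu, sem_update_of_notMem_fv M hy,
          Function.update_comm hyx]
    · rw [subst_of_notMem_fv _ _ _ hx, sem_update_of_notMem_fv M hx]

/-- A constant symbol is substitutable for any variable in any term. -/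
lemma substitutable_const (c : L.Const) (x : L.Var) (r : Term L) :
    Substitutable (const c) x r := by
  induction r with
  | const _ => trivial
  | var _ => trivial
  | app _ _ ih => exact ih
  | vapp _ _ ih => exact ih
  | ell G u y v ihu ihv => exact Or.inr (Or.inr ⟨id, ihu, ihv⟩)

/-- The syntactic and semantic interpretations agree. -/
theorem syn_eq_sem (M : VarStruct L) (s : L.Var → ℕ) (t : Term L) : t.syn M s = t.sem M s := by
  induction hd : t.depth using Nat.strong_induction_on generalizing t with
  | _ d ih =>
    subst hd
    cases t with
    | const c => simp only [syn, sem]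
    | var y => simp only [syn, sem]
    | app f ts =>
      have hts : ∀ i, (ts i).syn M s = (ts i).sem M s := fun i =>
        ih _ (Nat.lt_succ_of_le
          (Finset.le_sup (f := fun i => (ts i).depth) (Finset.mem_univ i))) _ rfl
      simp only [syn, sem, hts]
    | vapp G ts =>
      have hts : ∀ i, (ts i).syn M s = (ts i).sem M s := fun i =>
        ih _ (Nat.lt_succ_of_le
          (Finset.le_sup (f := fun i => (ts i).depth) (Finset.mem_univ i))) _ rfl
      simp only [syn, sem, hts]
    | ell G u y v =>
      have hv : v.syn M s = v.sem M s := ih _ (Nat.lt_succ_of_le (le_max_right _ _)) _ rfl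
      have hu : ∀ k, (u.subst y (const (L.num k))).syn M s =
          u.sem M (Function.update s y k) := by
        intro k
        rw [ih _ (Nat.lt_succ_of_le (le_max_left _ _)) _ (depth_subst_const y _ u),
          sem_subst M _ _ _ _ (substitutable_const _ _ _), sem, M.num_eq]
      simp only [syn, sem, hv, hu]

end Term

/-- **The Variadic Substitution Lemma for Terms.** If `t` is substitutable for `x` in `r`,
then `r(x|t)^s = r^{s(x|t^s)}`. -/
theorem variadic_substitution_lemma_terms {L : VarLang} (M : VarStruct L)
    (s : L.Var → ℕ) (r t : Term L) (x : L.Var) (h : Term.Substitutable t x r) :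
    (r.subst x t).syn M s = r.syn M (Function.update s x (t.syn M s)) := by
  simpa only [Term.syn_eq_sem] using Term.sem_subst M t x r s h
end

section
/- Let M be a structure for a variadic language L. For every term t of L and every assignment s, the syntactic interpretation and the semantic interpretation coincide: t^s = t_s. -/
namespace Term

/-- Substituting a constant symbol for `x` amounts to updating the assignment at `x`. -/
lemma sem_subst_const {L : VarLang} (M : VarStruct L) (x : L.Var) (c : L.Const) (u : Term L)
    (s : L.Var → ℕ) :
    (u.subst x (const c)).sem M s = u.sem M (Function.update s x (M.constI c)) := by
  induction u generalizing s with
  | const _ => rfl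
  | var y => by_cases h : y = x <;> simp [subst, sem, h]
  | app f ts ih => simp only [subst, sem, ih]
  | vapp G ts ih => simp only [subst, sem, ih]
  | ell G u y v ihu ihv =>
    by_cases h : y = x
    · subst h
      simp [subst, sem, ihv]
    · simp only [subst, if_neg h, sem, ihu, ihv, Function.update_comm h]

end Term

/-- The syntactic and semantic interpretations of any term coincide: `t^s = t_s`. -/
theorem syn_eq_sem {L : VarLang} (M : VarStruct L) (t : Term L) (s : L.Var → ℕ) :
    t.syn M s = t.sem M s := by
  induction t, s using Term.syn.induct with
  | case1 s c => simp only [Term.syn, Term.sem]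
  | case2 s x => simp only [Term.syn, Term.sem]
  | case3 s n f ts ih => simp only [Term.syn, Term.sem, ih]
  | case4 s n G ts ih => simp only [Term.syn, Term.sem, ih]
  | case5 s G u x v ihv ihu =>
    simp only [Term.syn, Term.sem, ihv, ihu, Term.sem_subst_const, M.num_eq]
end
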